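/- arXiv:math/0410429 — 6 statements merged into one kernel-verified Lean document; each statement's English description precedes it below -/
import Mathlib

section
/- For every n : ℕ, the total activity of the single-seeded rule 150 automaton at time 2^n − 1 is X(2^n − 1) = ⌊(2^(n+2) + 1)/3⌋ (the floor of (2^(n+2)+1)/3). -/
/-- Rule 150 elementary cellular automaton, started from a single seed at the origin. -/
def rule150 : ℕ → ℤ → ZMod 2
  | 0, n => if n = 0 then 1 else 0
  | t + 1, n => rule150 t (n - 1) + rule150 t n + rule150 t (n + 1)

/-- Total activity: the number of active sites at time `t`. -/
noncomputable def totalActivity (t : ℕ) : ℕ := {n : ℤ | rule150 t n = 1}.ncard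

theorem rule150_add_two_pow (n t : ℕ) (k : ℤ) :
    rule150 (t + 2 ^ n) k =
      rule150 t (k - 2 ^ n) + rule150 t k + rule150 t (k + 2 ^ n) := by
  induction n generalizing t k with
  | zero => simp [rule150]
  | succ n ih =>
    have h : t + 2 ^ (n + 1) = t + 2 ^ n + 2 ^ n := by ring
    rw [h, ih, ih, ih, ih, show k - 2 ^ n - 2 ^ n = k - 2 ^ (n + 1) by ring,
      show k + 2 ^ n + 2 ^ n = k + 2 ^ (n + 1) by ring, sub_add_cancel, add_sub_cancel_right]
    generalize rule150 t (k - 2 ^ (n + 1)) = a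
    generalize rule150 t (k - 2 ^ n) = b
    generalize rule150 t k = c
    generalize rule150 t (k + 2 ^ n) = d
    generalize rule150 t (k + 2 ^ (n + 1)) = e
    revert a b c d e
    decide

theorem two_pow_emod_three_ne_zero (n : ℕ) : (2 : ℤ) ^ n % 3 ≠ 0 := by
  induction n with
  | zero => norm_num
  | succ n ih => rw [pow_succ]; omega

theorem rule150_two_pow_sub_one (n : ℕ) (k : ℤ) :
    rule150 (2 ^ n - 1) k = if |k| < 2 ^ n ∧ (2 ^ n - |k|) % 3 ≠ 0 then 1 else 0 := by
  induction n generalizing k with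
  | zero =>
    have h : (|k| < 1 ∧ (1 - |k|) % 3 ≠ 0) ↔ k = 0 := by
      rcases abs_cases k with hk | hk <;> omega
    simp only [rule150, pow_zero, tsub_self, h]
  | succ n ih =>
    have hpos : 0 < 2 ^ n := Nat.two_pow_pos n
    rw [show 2 ^ (n + 1) - 1 = (2 ^ n - 1) + 2 ^ n by rw [pow_succ]; omega,
      rule150_add_two_pow, ih, ih, ih, pow_succ]
    have h3 := two_pow_emod_three_ne_zero n
    have hN : (0 : ℤ) < 2 ^ n := by positivity
    generalize (2 : ℤ) ^ n = N at *
    have hk := abs_cases k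
    have hl := abs_cases (k - N)
    have hr := abs_cases (k + N)
    generalize |k| = a, |k - N| = b, |k + N| = c at *
    have h2 : (1 + 1 : ZMod 2) = 0 := by decide
    split_ifs <;> simp only [h2, zero_add, add_zero, zero_ne_one, one_ne_zero] <;>
      rcases (by omega : N % 3 = 1 ∨ N % 3 = 2) with h1 | h1 <;> omega

theorem card_filter_not_three_dvd (m : ℕ) :
    ((Finset.Icc 1 m).filter fun j => ¬ 3 ∣ j).card = m - m / 3 := by
  induction m with
  | zero => rfl
  | succ m ih =>
    rw [← Finset.insert_Icc_right_eq_Icc_add_one (by omega), Finset.filter_insert]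
    split_ifs with h
    · rw [ih]; omega
    · rw [Finset.card_insert_of_notMem (by simp), ih]; omega

theorem ncard_abs_lt_and_emod_three_ne_zero (m : ℕ) (hm : (m + 1) % 3 ≠ 0) :
    {k : ℤ | |k| < m + 1 ∧ (m + 1 - |k|) % 3 ≠ 0}.ncard = 1 + 2 * (m - m / 3) := by
  set S := (Finset.Icc 1 m).filter fun j => ¬ 3 ∣ j
  have hS : {k : ℤ | |k| < m + 1 ∧ (m + 1 - |k|) % 3 ≠ 0} =
      ↑(insert 0 (S.image (fun j : ℕ => (m + 1 - j : ℤ)) ∪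
        S.image (fun j : ℕ => (j - (m + 1) : ℤ)))) := by
    ext k
    simp only [S, Set.mem_ofPred_eq, Finset.coe_insert, Finset.coe_union, Finset.coe_image,
      Set.mem_insert_iff, Set.mem_union, Set.mem_image, Finset.mem_coe, Finset.mem_filter,
      Finset.mem_Icc]
    constructor
    · intro h
      rcases lt_trichotomy k 0 with hk | hk | hk
      · rw [abs_of_neg hk] at h
        exact Or.inr (Or.inr ⟨(m + 1 + k).toNat, by omega, by omega⟩)
      · exact Or.inl hk
      · rw [abs_of_pos hk] at h
        exact Or.inr (Or.inl ⟨(m + 1 - k).toNat, by omega, by omega⟩)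
    · rintro (h | ⟨j, hj, h⟩ | ⟨j, hj, h⟩) <;> simp only [abs] <;> omega
  rw [hS, Set.ncard_coe_finset, Finset.card_insert_of_notMem, Finset.card_union_of_disjoint,
    Finset.card_image_of_injective, Finset.card_image_of_injective, card_filter_not_three_dvd]
  · ring
  · intro a b h; simp only at h; omega
  · intro a b h; simp only at h; omega
  · simp only [S, Finset.disjoint_left, Finset.mem_image, Finset.mem_filter, Finset.mem_Icc]
    rintro _ ⟨a, ha, rfl⟩ ⟨b, hb, h⟩
    omega
  · simp only [S, Finset.mem_union, Finset.mem_image, Finset.mem_filter, Finset.mem_Icc]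
    rintro (⟨a, ha, h⟩ | ⟨a, ha, h⟩) <;> omega

theorem totalActivity_pow_two_sub_one (n : ℕ) :
    (totalActivity (2 ^ n - 1) : ℤ) = ⌊((2 : ℚ) ^ (n + 2) + 1) / 3⌋ := by
  obtain ⟨m, hm⟩ : ∃ m, 2 ^ n = m + 1 := ⟨2 ^ n - 1, by have := Nat.two_pow_pos n; omega⟩
  have hmZ : (2 : ℤ) ^ n = m + 1 := mod_cast hm
  have hmQ : (2 : ℚ) ^ n = m + 1 := mod_cast hm
  have h3 := two_pow_emod_three_ne_zero n
  rw [hmZ] at h3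
  have hX : totalActivity (2 ^ n - 1) = 1 + 2 * (m - m / 3) := by
    rw [totalActivity, ← ncard_abs_lt_and_emod_three_ne_zero m (by omega)]
    simp [rule150_two_pow_sub_one, hmZ]
  have hfloor : ⌊((2 : ℚ) ^ (n + 2) + 1) / 3⌋ = (4 * (m + 1) + 1 : ℤ) / 3 := by
    rw [pow_add, hmQ]
    convert Rat.floor_intCast_div_natCast (4 * (m + 1) + 1) 3 using 2
    · push_cast
      ring
    · norm_num
  rw [hX, hfloor]
  obtain ⟨q, rfl | rfl⟩ : ∃ q, m = 3 * q ∨ m = 3 * q + 1 := ⟨m / 3, by omega⟩ <;> omega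
end

section
/- First branch of the two-step (Fibonacci-like) iteration for the rule 150 total activity: for all n : ℕ and all t : ℕ with t < 2^n, X(2^(n+1) + t) = 3·X(t). -/
theorem rule150_eq_zero_of_lt_abs (t : ℕ) (m : ℤ) (h : (t : ℤ) < |m|) : rule150 t m = 0 := by
  induction t generalizing m with
  | zero =>
    have hm : m ≠ 0 := by rintro rfl; simp at h
    simp [rule150, hm]
  | succ t ih =>
    push_cast at h
    rw [rule150, ih (m - 1) (by grind), ih m (by grind), ih (m + 1) (by grind)]
    simp

theorem abs_le_of_rule150_eq_one {t : ℕ} {m : ℤ} (h : rule150 t m = 1) : |m| ≤ t := by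
  by_contra! hm
  simp [rule150_eq_zero_of_lt_abs t m hm] at h

theorem rule150_two_pow_add (k t : ℕ) (m : ℤ) :
    rule150 (2 ^ k + t) m = rule150 t (m - 2 ^ k) + rule150 t m + rule150 t (m + 2 ^ k) := by
  induction k generalizing t m with
  | zero => simp [add_comm 1 t, rule150]
  | succ k ih =>
    rw [show 2 ^ (k + 1) + t = 2 ^ k + (2 ^ k + t) by ring, ih, ih, ih, ih,
      show m - 2 ^ k - 2 ^ k = m - 2 ^ (k + 1) by ring, sub_add_cancel, add_sub_cancel_right,
      show m + 2 ^ k + 2 ^ k = m + 2 ^ (k + 1) by ring]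
    generalize rule150 t (m - 2 ^ (k + 1)) = a, rule150 t (m - 2 ^ k) = b, rule150 t m = c,
      rule150 t (m + 2 ^ k) = d, rule150 t (m + 2 ^ (k + 1)) = e
    linear_combination (b + c + d) * CharTwo.two_eq_zero (R := ZMod 2)

theorem finite_setOf_rule150_eq_one (t : ℕ) : {m : ℤ | rule150 t m = 1}.Finite :=
  (Set.finite_Icc (-(t : ℤ)) t).subset fun _ h => abs_le.mp (abs_le_of_rule150_eq_one h)

theorem totalActivity_first_branch (n t : ℕ) (ht : t < 2 ^ n) :
    totalActivity (2 ^ (n + 1) + t) = 3 * totalActivity t := by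
  set N : ℤ := 2 ^ (n + 1) with hN
  have hlt : 2 * (t : ℤ) < N := by
    have : (t : ℤ) < 2 ^ n := by exact_mod_cast ht
    rw [hN, pow_succ]
    linarith
  clear_value N
  set S : Set ℤ := {m | rule150 t m = 1} with hS
  have hfin : S.Finite := finite_setOf_rule150_eq_one t
  have habs : ∀ m ∈ S, |m| ≤ t := fun m hm => abs_le_of_rule150_eq_one hm
  have hunion : {m : ℤ | rule150 (2 ^ (n + 1) + t) m = 1} =
      ((· + N) '' S ∪ S) ∪ (· - N) '' S := by
    ext m
    have hleft : m ∈ (· + N) '' S ↔ rule150 t (m - N) = 1 := by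
      simp [hS, ← sub_eq_add_neg]
    have hright : m ∈ (· - N) '' S ↔ rule150 t (m + N) = 1 := by
      simp [hS, sub_eq_iff_eq_add]
    rw [Set.mem_union, Set.mem_union, hleft, hright, Set.mem_ofPred_eq, rule150_two_pow_add, ← hN,
      hS, Set.mem_ofPred_eq]
    have h₁ := rule150_eq_zero_of_lt_abs t (m - N)
    have h₂ := rule150_eq_zero_of_lt_abs t m
    have h₃ := rule150_eq_zero_of_lt_abs t (m + N)
    rcases le_or_gt |m - N| t with ha | ha
    · rw [abs_le] at ha
      rw [h₂ (lt_abs.mpr (by omega)), h₃ (lt_abs.mpr (by omega))]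
      simp
    · rw [h₁ ha]
      rcases le_or_gt |m| t with hb | hb
      · rw [abs_le] at hb
        rw [h₃ (lt_abs.mpr (by omega))]
        simp
      · rw [h₂ hb]
        simp
  have hdisj₁ : Disjoint ((· + N) '' S) S := by
    rw [Set.disjoint_left]
    rintro _ ⟨a, ha, rfl⟩ hb
    have := abs_le.mp (habs a ha)
    have := abs_le.mp (habs _ hb)
    lia
  have hdisj₂ : Disjoint ((· + N) '' S ∪ S) ((· - N) '' S) := by
    rw [Set.disjoint_right]
    rintro _ ⟨a, ha, rfl⟩ (⟨b, hb, hab⟩ | hb)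
    · have := abs_le.mp (habs a ha)
      have := abs_le.mp (habs b hb)
      lia
    · have := abs_le.mp (habs a ha)
      have := abs_le.mp (habs _ hb)
      lia
  rw [totalActivity, totalActivity, hunion,
    Set.ncard_union_eq hdisj₂ ((hfin.image _).union hfin) (hfin.image _),
    Set.ncard_union_eq hdisj₁ (hfin.image _) hfin,
    Set.ncard_image_of_injective _ (add_left_injective N),
    Set.ncard_image_of_injective _ sub_left_injective]
  ring
end

section
/- Closed multiplicative formula for the rule 150 total activity in terms of the binary expansion: for every t : ℕ, X(t) = ∏_{n ≥ 1} (⌊(2^(n+2)+1)/3⌋)^(c_n(t)), where c_n(t) is the number of maximal runs of exactly n consecutive ones in the binary expansion of t (the product has only finitely many factors different from 1). -/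
/-- The number of maximal runs of exactly `n` consecutive ones in the binary expansion
of `t`: indices `i` at which such a run starts. -/
noncomputable def runCount (t n : ℕ) : ℕ :=
  {i : ℕ | (∀ j : ℕ, j < n → Nat.testBit t (i + j) = true)
    ∧ Nat.testBit t (i + n) = false
    ∧ (i = 0 ∨ Nat.testBit t (i - 1) = false)}.ncard

theorem rule150_succ_succ (t : ℕ) (n : ℤ) :
    rule150 (t + 2) n = rule150 t (n - 2) + rule150 t n + rule150 t (n + 2) := by
  have h2 : (2 : ZMod 2) = 0 := rfl
  simp only [rule150]
  rw [show n - 1 - 1 = n - 2 by ring, show n - 1 + 1 = n by ring, show n + 1 - 1 = n by ring,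
    show n + 1 + 1 = n + 2 by ring]
  linear_combination (rule150 t (n - 1) + rule150 t n + rule150 t (n + 1)) * h2

theorem rule150_two_mul (t : ℕ) (n : ℤ) :
    rule150 (2 * t) (2 * n) = rule150 t n ∧ rule150 (2 * t) (2 * n + 1) = 0 := by
  induction t generalizing n with
  | zero =>
    refine ⟨?_, ?_⟩
    · simp [rule150]
    · have : 2 * n + 1 ≠ 0 := by omega
      simp [rule150, this]
  | succ t ih =>
    rw [show 2 * (t + 1) = 2 * t + 2 by ring, rule150_succ_succ, rule150_succ_succ,
      show 2 * n - 2 = 2 * (n - 1) by ring, show 2 * n + 2 = 2 * (n + 1) by ring,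
      show 2 * n + 1 - 2 = 2 * (n - 1) + 1 by ring, show 2 * n + 1 + 2 = 2 * (n + 1) + 1 by ring]
    simp [ih, rule150]

theorem rule150_two_mul_add_one_even (t : ℕ) (n : ℤ) :
    rule150 (2 * t + 1) (2 * n) = rule150 t n := by
  rw [rule150, show 2 * n - 1 = 2 * (n - 1) + 1 by ring]
  simp [rule150_two_mul]

theorem rule150_two_mul_add_one_odd (t : ℕ) (n : ℤ) :
    rule150 (2 * t + 1) (2 * n + 1) = rule150 t n + rule150 t (n + 1) := by
  rw [rule150, show 2 * n + 1 - 1 = 2 * n by ring, show 2 * n + 1 + 1 = 2 * (n + 1) by ring]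
  simp [rule150_two_mul]

theorem rule150_eq_zero_of_lt_natAbs {t : ℕ} {n : ℤ} (h : t < n.natAbs) : rule150 t n = 0 := by
  induction t generalizing n with
  | zero =>
    have : n ≠ 0 := by omega
    simp [rule150, this]
  | succ t ih => rw [rule150, ih (by omega), ih (by omega), ih (by omega)]; simp

theorem finite_setOf_rule150 (t : ℕ) : {n : ℤ | rule150 t n = 1}.Finite := by
  refine (Set.finite_Icc (-(t : ℤ)) t).subset fun n hn => ?_
  by_contra h
  rw [Set.mem_Icc] at h
  rw [Set.mem_ofPred_eq, rule150_eq_zero_of_lt_natAbs (by omega)] at hn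
  exact zero_ne_one hn

/-- The number of sites at which the configuration at time `t` differs from its right
neighbour. -/
noncomputable def boundaryCount (t : ℕ) : ℕ :=
  {n : ℤ | rule150 t n + rule150 t (n + 1) = 1}.ncard

theorem finite_setOf_rule150_add (t : ℕ) :
    {n : ℤ | rule150 t n + rule150 t (n + 1) = 1}.Finite := by
  refine (Set.finite_Icc (-(t : ℤ) - 1) t).subset fun n hn => ?_
  by_contra h
  rw [Set.mem_Icc] at h
  rw [Set.mem_ofPred_eq, rule150_eq_zero_of_lt_natAbs (by omega),
    rule150_eq_zero_of_lt_natAbs (by omega), add_zero] at hn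
  exact zero_ne_one hn

theorem ncard_eq_ncard_even_add_ncard_odd {p : ℤ → Prop} (hp : {n | p n}.Finite) :
    {n | p n}.ncard = {n | p (2 * n)}.ncard + {n | p (2 * n + 1)}.ncard := by
  have he : Function.Injective fun n : ℤ => 2 * n := fun a b h => by simpa using h
  have ho : Function.Injective fun n : ℤ => 2 * n + 1 := fun a b h => by simpa using h
  rw [← Set.ncard_image_of_injective {n | p (2 * n)} he,
    ← Set.ncard_image_of_injective {n | p (2 * n + 1)} ho, ← Set.ncard_union_eq ?_
      (hp.subset (by rintro _ ⟨a, ha, rfl⟩; exact ha))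
      (hp.subset (by rintro _ ⟨a, ha, rfl⟩; exact ha))]
  · congr 1
    ext m
    simp only [Set.mem_union, Set.mem_image, Set.mem_ofPred_eq]
    constructor
    · intro hm
      rcases Int.even_or_odd' m with ⟨c, rfl | rfl⟩
      · exact Or.inl ⟨c, hm, rfl⟩
      · exact Or.inr ⟨c, hm, rfl⟩
    · rintro (⟨c, hc, rfl⟩ | ⟨c, hc, rfl⟩) <;> exact hc
  · rw [Set.disjoint_left]
    rintro _ ⟨a, -, rfl⟩ ⟨b, -, h⟩
    simp only at h
    omega

theorem ncard_setOf_rule150_add_one (t : ℕ) :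
    {n : ℤ | rule150 t (n + 1) = 1}.ncard = totalActivity t := by
  rw [totalActivity, ← Set.ncard_image_of_injective _ (add_left_injective (1 : ℤ))]
  congr 1
  ext m
  simp only [Set.mem_image, Set.mem_ofPred_eq]
  exact ⟨by rintro ⟨c, hc, rfl⟩; exact hc, fun h => ⟨m - 1, by simpa using h, by ring⟩⟩

theorem totalActivity_two_mul (t : ℕ) : totalActivity (2 * t) = totalActivity t := by
  rw [totalActivity, ncard_eq_ncard_even_add_ncard_odd (finite_setOf_rule150 _)]
  simp [rule150_two_mul, totalActivity]

theorem totalActivity_two_mul_add_one (t : ℕ) :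
    totalActivity (2 * t + 1) = totalActivity t + boundaryCount t := by
  rw [totalActivity, ncard_eq_ncard_even_add_ncard_odd (finite_setOf_rule150 _)]
  simp only [rule150_two_mul_add_one_even, rule150_two_mul_add_one_odd]
  rfl

theorem boundaryCount_two_mul (t : ℕ) : boundaryCount (2 * t) = 2 * totalActivity t := by
  rw [boundaryCount, ncard_eq_ncard_even_add_ncard_odd (finite_setOf_rule150_add _)]
  simp only [show ∀ n : ℤ, 2 * n + 1 + 1 = 2 * (n + 1) by intro n; ring, rule150_two_mul,
    add_zero, zero_add, ncard_setOf_rule150_add_one]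
  rw [two_mul]
  rfl

theorem boundaryCount_two_mul_add_one (t : ℕ) :
    boundaryCount (2 * t + 1) = 2 * totalActivity t := by
  have h (a b : ZMod 2) : a + (a + b) = b := by rw [← add_assoc, CharTwo.add_self_eq_zero, zero_add]
  have h' (a b : ZMod 2) : a + b + b = a := by rw [add_assoc, CharTwo.add_self_eq_zero, add_zero]
  rw [boundaryCount, ncard_eq_ncard_even_add_ncard_odd (finite_setOf_rule150_add _)]
  simp only [show ∀ n : ℤ, 2 * n + 1 + 1 = 2 * (n + 1) by intro n; ring,
    rule150_two_mul_add_one_even, rule150_two_mul_add_one_odd, h, h', ncard_setOf_rule150_add_one]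
  rw [two_mul, totalActivity]

theorem two_pow_add_two_add_one_div_three (k : ℕ) :
    (2 ^ (k + 2 + 2) + 1) / 3 = (2 ^ (k + 1 + 2) + 1) / 3 + 2 * ((2 ^ (k + 2) + 1) / 3) := by
  have h : 2 ^ (k + 2) % 3 = 1 ∨ 2 ^ (k + 2) % 3 = 2 := by
    induction k with
    | zero => simp
    | succ k ih => rw [show k + 1 + 2 = k + 2 + 1 by ring, pow_succ]; omega
  rw [show k + 2 + 2 = k + 2 + 1 + 1 by ring, show k + 1 + 2 = k + 2 + 1 by ring, pow_succ _ (_ + 1),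
    pow_succ _ (k + 2)]
  omega

theorem totalActivity_two_pow_mul_add (s k : ℕ) :
    totalActivity (2 ^ (k + 1) * s + (2 ^ k - 1)) = (2 ^ (k + 2) + 1) / 3 * totalActivity s := by
  suffices totalActivity (2 ^ (k + 1) * s + (2 ^ k - 1)) = (2 ^ (k + 2) + 1) / 3 * totalActivity s ∧
      totalActivity (2 ^ (k + 1) * s + (2 ^ k - 1)) + boundaryCount (2 ^ (k + 1) * s + (2 ^ k - 1))
        = (2 ^ (k + 1 + 2) + 1) / 3 * totalActivity s from this.1
  induction k with
  | zero =>
    simp only [zero_add, pow_one, pow_zero, Nat.sub_self, add_zero, totalActivity_two_mul,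
      boundaryCount_two_mul]
    norm_num
    ring
  | succ k ih =>
    have hk : 2 ^ (k + 1 + 1) * s + (2 ^ (k + 1) - 1) = 2 * (2 ^ (k + 1) * s + (2 ^ k - 1)) + 1 := by
      have := Nat.one_le_two_pow (n := k)
      have e : 2 ^ (k + 1 + 1) * s = 2 * (2 ^ (k + 1) * s) := by ring
      rw [e, pow_succ 2 k]
      omega
    rw [hk, totalActivity_two_mul_add_one, boundaryCount_two_mul_add_one, ih.2, ih.1,
      show k + 1 + 1 + 2 = k + 2 + 2 by ring, two_pow_add_two_add_one_div_three]
    exact ⟨rfl, by ring⟩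

theorem testBit_two_pow_mul_add_two_pow_sub_one (s k j : ℕ) :
    (2 ^ (k + 1) * s + (2 ^ k - 1)).testBit j
      = if j < k + 1 then decide (j < k) else s.testBit (j - (k + 1)) := by
  have h : 2 ^ k - 1 < 2 ^ (k + 1) := by
    have := Nat.one_le_two_pow (n := k)
    rw [pow_succ]; omega
  rw [Nat.testBit_two_pow_mul_add _ h, Nat.testBit_two_pow_sub_one]

theorem lt_of_forall_testBit_add {t i n : ℕ} (hn : 1 ≤ n)
    (h : ∀ j < n, t.testBit (i + j) = true) : i + (n - 1) < t :=
  Nat.lt_two_pow_self.trans_le (Nat.ge_two_pow_of_testBit (h (n - 1) (by omega)))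

theorem runCount_eq_zero {t n : ℕ} (hn : 1 ≤ n) (h : t < n) : runCount t n = 0 := by
  rw [runCount, Set.eq_empty_of_forall_notMem (s := {i | _}), Set.ncard_empty]
  rintro i ⟨hi, -, -⟩
  have := lt_of_forall_testBit_add hn hi
  omega

theorem runCount_two_pow_mul_add (s k : ℕ) {n : ℕ} (hn : 1 ≤ n) :
    runCount (2 ^ (k + 1) * s + (2 ^ k - 1)) n = runCount s n + if n = k then 1 else 0 := by
  have hfin : {i : ℕ | (∀ j : ℕ, j < n → Nat.testBit s (i + j) = true)
      ∧ Nat.testBit s (i + n) = false ∧ (i = 0 ∨ Nat.testBit s (i - 1) = false)}.Finite := by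
    refine (Set.finite_Iio s).subset fun i hi => ?_
    have := lt_of_forall_testBit_add hn hi.1
    rw [Set.mem_Iio]
    omega
  have hsingle : (if n = k then ({0} : Set ℕ) else ∅).ncard = if n = k then 1 else 0 := by
    split_ifs <;> simp
  rw [runCount, runCount, ← hsingle,
    ← Set.ncard_image_of_injective {i | (∀ j < n, s.testBit (i + j) = true) ∧ _}
      (add_left_injective (k + 1)),
    ← Set.ncard_union_eq _ (hfin.image _) (by split_ifs <;> simp)]
  · congr 1
    ext i
    simp only [Set.mem_union, Set.mem_image, Set.mem_ofPred_eq,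
      testBit_two_pow_mul_add_two_pow_sub_one]
    constructor
    · rintro ⟨h1, h2, h3⟩
      rcases Nat.lt_or_ge i (k + 1) with hik | hik
      · right
        have h0 := h1 0 hn
        have hi : i = 0 := by
          rcases h3 with h3 | h3
          · exact h3
          · rw [if_pos (by omega)] at h0 h3
            simp at h0 h3
            omega
        subst hi
        have hnk : n = k := by
          rcases lt_trichotomy n k with h | h | h
          · rw [if_pos (by omega)] at h2
            simp at h2
            omega
          · exact h
          · have := h1 k h
            simp at this
        simp [hnk]
      · left
        obtain ⟨m, rfl⟩ := Nat.exists_eq_add_of_le' hik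
        refine ⟨m, ⟨fun j hj => ?_, ?_, ?_⟩, rfl⟩
        · have := h1 j hj
          rwa [if_neg (by omega), show m + (k + 1) + j - (k + 1) = m + j by omega] at this
        · rwa [if_neg (by omega), show m + (k + 1) + n - (k + 1) = m + n by omega] at h2
        · rcases Nat.eq_zero_or_pos m with hm | hm
          · exact Or.inl hm
          · right
            rcases h3 with h3 | h3
            · omega
            · rwa [if_neg (by omega), show m + (k + 1) - 1 - (k + 1) = m - 1 by omega] at h3
    · rintro (⟨m, ⟨h1, h2, h3⟩, rfl⟩ | h)
      · refine ⟨fun j hj => ?_, ?_, Or.inr ?_⟩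
        · rw [if_neg (by omega), show m + (k + 1) + j - (k + 1) = m + j by omega]
          exact h1 j hj
        · rwa [if_neg (by omega), show m + (k + 1) + n - (k + 1) = m + n by omega]
        · rcases Nat.eq_zero_or_pos m with hm | hm
          · subst hm
            simp
          · rw [if_neg (by omega), show m + (k + 1) - 1 - (k + 1) = m - 1 by omega]
            exact h3.resolve_left (by omega)
      · split_ifs at h with hnk
        · obtain rfl : i = 0 := h
          subst hnk
          refine ⟨fun j hj => ?_, by simp, Or.inl rfl⟩
          rw [if_pos (by omega)]
          simpa using hj
        · exact h.elim
  · rw [Set.disjoint_left]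
    rintro _ ⟨a, -, rfl⟩ h
    split_ifs at h <;> simp at h

theorem exists_eq_two_pow_mul_add {t : ℕ} (ht : t ≠ 0) :
    ∃ k s, s < t ∧ t = 2 ^ (k + 1) * s + (2 ^ k - 1) := by
  obtain ⟨k, m, ⟨s, rfl⟩, h⟩ := Nat.exists_eq_two_pow_mul_odd (n := t + 1) (by omega)
  have hk := Nat.one_le_two_pow (n := k)
  have h' : t + 1 = 2 * (2 ^ k * s) + 2 ^ k := by rw [h]; ring
  have hs : s ≤ 2 ^ k * s := Nat.le_mul_of_pos_left s hk
  have e : 2 ^ (k + 1) * s = 2 * (2 ^ k * s) := by ring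
  exact ⟨k, s, by omega, by omega⟩

theorem totalActivity_closed_multiplicative (t : ℕ) :
    totalActivity t
      = ∏ᶠ (n : ℕ) (_ : 1 ≤ n), ((2 ^ (n + 2) + 1) / 3) ^ runCount t n := by
  induction t using Nat.strong_induction_on with
  | _ t ih =>
    rcases eq_or_ne t 0 with rfl | ht
    · have h1 : totalActivity 0 = 1 := by simp [totalActivity, rule150]
      rw [h1]
      refine (finprod_mem_eq_one_of_forall_eq_one fun n (hn : n ∈ Set.Ici 1) => ?_).symm
      rw [runCount_eq_zero hn (Nat.lt_of_lt_of_le Nat.one_pos hn), pow_zero]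
    · obtain ⟨k, s, hs, rfl⟩ := exists_eq_two_pow_mul_add ht
      rw [totalActivity_two_pow_mul_add, ih s hs]
      have hsplit : ∏ᶠ (n : ℕ) (_ : n ∈ Set.Ici 1),
          ((2 ^ (n + 2) + 1) / 3) ^ runCount (2 ^ (k + 1) * s + (2 ^ k - 1)) n
          = ∏ᶠ (n : ℕ) (_ : n ∈ Set.Ici 1), (((2 ^ (n + 2) + 1) / 3) ^ runCount s n *
            if n = k then (2 ^ (n + 2) + 1) / 3 else 1) := by
        refine finprod_mem_congr rfl fun n hn => ?_
        rw [runCount_two_pow_mul_add s k hn, pow_add]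
        split_ifs <;> simp
      have hlast : ∏ᶠ (n : ℕ) (_ : n ∈ Set.Ici 1), (if n = k then (2 ^ (n + 2) + 1) / 3 else 1)
          = (2 ^ (k + 2) + 1) / 3 := by
        rw [finprod_eq_single _ k fun n hn => by simp [hn]]
        rcases Nat.eq_zero_or_pos k with rfl | hk
        · simp
        · rw [finprod_eq_if, if_pos (Set.mem_Ici.2 hk), if_pos rfl]
      refine Eq.trans ?_ hsplit.symm
      rw [finprod_mem_mul_distrib', hlast, mul_comm]
      · rfl
      · refine (Set.finite_Iic s).subset fun n hn => ?_
        by_contra h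
        exact hn.2 (by simp [runCount_eq_zero hn.1 (not_le.1 h)])
      · refine (Set.finite_singleton k).subset fun n hn => ?_
        by_contra h
        exact hn.2 (if_neg h)
end

section
/- For the rule 90 (Sierpinski) cellular automaton started from a single seed, the total activity factorizes over the binary digits of time: for every t : ℕ, X₉₀(t) = 2^(s(t)), where s(t) is the number of ones in the binary expansion of t. -/
/-- Rule 90 elementary cellular automaton, started from a single seed at the origin. -/
def rule90 : ℕ → ℤ → ZMod 2
  | 0, n => if n = 0 then 1 else 0
  | t + 1, n => rule90 t (n - 1) + rule90 t (n + 1)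

/-- Total activity of rule 90: the number of active sites at time `t`. -/
noncomputable def totalActivity90 (t : ℕ) : ℕ := {n : ℤ | rule90 t n = 1}.ncard

theorem rule90_succ (t : ℕ) (n : ℤ) :
    rule90 (t + 1) n = rule90 t (n - 1) + rule90 t (n + 1) := rfl

/-- Over `ZMod 2` two steps of rule 90 act as a single step with spacing two. -/
theorem rule90_add_two (t : ℕ) (n : ℤ) :
    rule90 (t + 2) n = rule90 t (n - 2) + rule90 t (n + 2) := by
  have h := CharTwo.add_self_eq_zero (rule90 t n)
  rw [rule90_succ, rule90_succ, rule90_succ, sub_sub, sub_add_cancel, add_sub_cancel_right,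
    add_assoc n, one_add_one_eq_two]
  linear_combination h

theorem rule90_two_mul_two_mul (t : ℕ) (n : ℤ) : rule90 (2 * t) (2 * n) = rule90 t n := by
  induction t generalizing n with
  | zero => simp [rule90]
  | succ t ih =>
    rw [Nat.mul_succ, rule90_add_two, rule90_succ, ← ih, ← ih, mul_sub, mul_add, mul_one]

/-- A site can only be active when its parity agrees with that of the time. -/
theorem rule90_eq_zero_of_odd_add (t : ℕ) (n : ℤ) (h : Odd (t + n)) : rule90 t n = 0 := by
  induction t generalizing n with
  | zero =>
    refine if_neg ?_
    rintro rfl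
    simp at h
  | succ t ih =>
    push_cast at h
    rw [rule90_succ, ih _ (by grind), ih _ (by grind), add_zero]

theorem even_add_of_rule90_eq_one {t : ℕ} {n : ℤ} (h : rule90 t n = 1) : Even (t + n) := by
  by_contra hodd
  rw [rule90_eq_zero_of_odd_add t n (Int.not_even_iff_odd.mp hodd)] at h
  exact zero_ne_one h

theorem rule90_two_mul_add_one (t : ℕ) (n : ℤ) :
    rule90 (2 * t + 1) (2 * n + 1) = rule90 t n + rule90 t (n + 1) := by
  rw [rule90_succ, add_sub_cancel_right, ← rule90_two_mul_two_mul t n,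
    ← rule90_two_mul_two_mul t (n + 1), mul_add, mul_one, add_assoc, one_add_one_eq_two]

theorem setOf_rule90_two_mul (t : ℕ) :
    {n | rule90 (2 * t) n = 1} = (fun n : ℤ => 2 * n) '' {n | rule90 t n = 1} := by
  ext m
  simp only [Set.mem_ofPred_eq, Set.mem_image]
  constructor
  · intro h
    obtain ⟨k, rfl⟩ : ∃ k, m = 2 * k := by
      have := even_add_of_rule90_eq_one h
      push_cast at this
      exact even_iff_exists_two_mul.mp (by grind)
    exact ⟨k, by rwa [rule90_two_mul_two_mul] at h, rfl⟩
  · rintro ⟨k, hk, rfl⟩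
    rwa [rule90_two_mul_two_mul]

theorem setOf_rule90_two_mul_add_one (t : ℕ) :
    {n | rule90 (2 * t + 1) n = 1} =
      (fun n : ℤ => 2 * n + 1) '' {n | rule90 t n = 1} ∪
        (fun n : ℤ => 2 * n - 1) '' {n | rule90 t n = 1} := by
  ext m
  simp only [Set.mem_ofPred_eq, Set.mem_union, Set.mem_image]
  constructor
  · intro h
    obtain ⟨k, rfl⟩ : Odd m := by
      have := even_add_of_rule90_eq_one h
      push_cast at this
      grind
    rw [rule90_two_mul_add_one] at h
    rcases Int.even_or_odd (t + k) with hk | hk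
    · rw [rule90_eq_zero_of_odd_add t (k + 1) (by grind), add_zero] at h
      exact Or.inl ⟨k, h, rfl⟩
    · rw [rule90_eq_zero_of_odd_add t k hk, zero_add] at h
      exact Or.inr ⟨k + 1, h, by ring⟩
  · rintro (⟨k, hk, rfl⟩ | ⟨k, hk, rfl⟩) <;> have hpar := even_add_of_rule90_eq_one hk
    · rw [rule90_two_mul_add_one, hk, rule90_eq_zero_of_odd_add t (k + 1) (by grind), add_zero]
    · rw [show 2 * k - 1 = 2 * (k - 1) + 1 by ring, rule90_two_mul_add_one, sub_add_cancel, hk,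
        rule90_eq_zero_of_odd_add t (k - 1) (by grind), zero_add]

theorem finite_setOf_rule90 (t : ℕ) : {n | rule90 t n = 1}.Finite := by
  induction t with
  | zero => exact (Set.finite_singleton (0 : ℤ)).subset fun n hn => by simpa [rule90] using hn
  | succ t ih =>
    refine ((ih.image (· + 1)).union (ih.image (· - 1))).subset fun n hn => ?_
    by_cases h : rule90 t (n - 1) = 1
    · exact Or.inl ⟨n - 1, h, sub_add_cancel n 1⟩
    · refine Or.inr ⟨n + 1, ?_, add_sub_cancel_right n 1⟩
      have h0 : rule90 t (n - 1) = 0 := by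
        generalize rule90 t (n - 1) = x at h
        revert x
        decide
      rwa [Set.mem_ofPred_eq, rule90_succ, h0, zero_add] at hn

theorem totalActivity90_zero : totalActivity90 0 = 1 := by
  simp [totalActivity90, rule90]

theorem totalActivity90_two_mul (t : ℕ) : totalActivity90 (2 * t) = totalActivity90 t := by
  rw [totalActivity90, setOf_rule90_two_mul]
  exact Set.ncard_image_of_injective _ fun a b h => by grind

theorem totalActivity90_two_mul_add_one (t : ℕ) :
    totalActivity90 (2 * t + 1) = 2 * totalActivity90 t := by
  have hfin := finite_setOf_rule90 t
  rw [totalActivity90, setOf_rule90_two_mul_add_one,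
    Set.ncard_union_eq ?_ (hfin.image _) (hfin.image _),
    Set.ncard_image_of_injective _ fun a b h => by grind,
    Set.ncard_image_of_injective _ fun a b h => by grind, two_mul, totalActivity90]
  rw [Set.disjoint_left]
  rintro _ ⟨a, ha, rfl⟩ ⟨b, hb, hab⟩
  have := even_add_of_rule90_eq_one ha
  have := even_add_of_rule90_eq_one hb
  grind

theorem totalActivity90_eq_two_pow_digitSum (t : ℕ) :
    totalActivity90 t = 2 ^ (Nat.digits 2 t).sum := by
  induction t using Nat.strong_induction_on with
  | _ t ih =>
    rcases t.eq_zero_or_pos with rfl | hpos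
    · simp [totalActivity90_zero]
    rw [Nat.digits_def' one_lt_two hpos, List.sum_cons, pow_add,
      ← ih (t / 2) (Nat.div_lt_self hpos one_lt_two)]
    obtain ⟨k, rfl | rfl⟩ := t.even_or_odd'
    · rw [totalActivity90_two_mul, Nat.mul_mod_right, pow_zero, one_mul,
        Nat.mul_div_cancel_left k two_pos]
    · rw [totalActivity90_two_mul_add_one, show (2 * k + 1) % 2 = 1 by lia,
        show (2 * k + 1) / 2 = k by lia, pow_one]
end

section
/- For the rule 90 (Sierpinski) cellular automaton started from a single seed, the state at time t and site n is given by binomial coefficients mod 2: for every t : ℕ and every n : ℤ with -t ≤ n ≤ t, the value y t n equals the coefficient of X^(n+t) in the polynomial (1 + X^2)^t over ZMod 2 (and y t n = 0 whenever |n| > t). -/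
/-- Information travels at most one site per step. -/
theorem rule90_eq_zero_of_lt_abs (t : ℕ) (n : ℤ) (h : (t : ℤ) < |n|) : rule90 t n = 0 := by
  induction t generalizing n with
  | zero => simpa [rule90] using h
  | succ t ih =>
    rw [rule90, ih (n - 1) (by grind), ih (n + 1) (by grind), add_zero]

theorem rule90_natCast_sub (t k : ℕ) :
    rule90 t (k - t) = ((1 + Polynomial.X ^ 2 : Polynomial (ZMod 2)) ^ t).coeff k := by
  induction t generalizing k with
  | zero => simp [rule90, Polynomial.coeff_one]
  | succ t ih =>
    have hr : (k : ℤ) - (t + 1 : ℕ) + 1 = k - t := by push_cast; ring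
    rw [pow_succ, mul_add, mul_one, Polynomial.coeff_add, Polynomial.coeff_mul_X_pow',
      rule90, hr, ih, add_comm]
    congr 1
    split_ifs with hk
    · rw [← ih, Nat.cast_sub hk]
      congr 1
      push_cast
      ring
    · exact rule90_eq_zero_of_lt_abs t _ (by grind)

theorem rule90_eq_binomial_coeff :
    (∀ (t : ℕ) (n : ℤ), -(t : ℤ) ≤ n → n ≤ (t : ℤ) →
      rule90 t n =
        ((1 + Polynomial.X ^ 2 : Polynomial (ZMod 2)) ^ t).coeff (n + t).toNat)
    ∧ (∀ (t : ℕ) (n : ℤ), (t : ℤ) < |n| → rule90 t n = 0) := by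
  refine ⟨fun t n h _ => ?_, rule90_eq_zero_of_lt_abs⟩
  rw [← rule90_natCast_sub]
  congr 1
  omega
end

section
/- Additivity of rule 150 under time composition (the basis of the generating-function solution): for the single-seeded rule 150 automaton and all s, t : ℕ and n : ℤ, the row at time s + t is the mod-2 convolution of the rows at times s and t, i.e. x (s+t) n = ∑_{m} x s m · x t (n − m), where the sum runs over the finitely many m ∈ ℤ with x s m ≠ 0. -/
theorem finite_support_rule150 (t : ℕ) : (Function.support (rule150 t)).Finite := by
  refine (Set.finite_Icc (-t : ℤ) t).subset fun n hn => ?_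
  contrapose! hn
  rw [Function.notMem_support]
  induction t generalizing n with
  | zero =>
    have hn0 : n ≠ 0 := by rintro rfl; simp at hn
    simp [rule150, hn0]
  | succ t ih =>
    simp only [Set.mem_Icc, Nat.cast_add, Nat.cast_one] at hn ih
    rw [rule150, ih (n - 1) (by lia), ih n (by lia), ih (n + 1) (by lia)]
    simp

theorem finite_support_rule150_mul (s : ℕ) (f : ℤ → ZMod 2) :
    (Function.support fun m => rule150 s m * f m).Finite :=
  (finite_support_rule150 s).subset (Function.support_mul_subset_left _ _)

theorem rule150_time_additivity (s t : ℕ) (n : ℤ) :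
    rule150 (s + t) n = ∑ᶠ m : ℤ, rule150 s m * rule150 t (n - m) := by
  induction t generalizing n with
  | zero =>
    rw [finsum_eq_single _ n fun m hm => by simp [rule150, sub_eq_zero, hm.symm]]
    simp [rule150]
  | succ t ih =>
    rw [← add_assoc, rule150, ih, ih, ih,
      ← finsum_add_distrib (finite_support_rule150_mul s _) (finite_support_rule150_mul s _),
      ← finsum_add_distrib _ (finite_support_rule150_mul s _)]
    · refine finsum_congr fun m => ?_
      rw [rule150, sub_right_comm n 1 m, add_sub_right_comm n 1 m]
      ring
    · simp only [← mul_add]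
      exact finite_support_rule150_mul s _
end
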